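/- The common vanishing locus in ℂ⁴ of the six polynomials φ(b₁), …, φ(b₆), where b₁ = z₃z₇ + 2z₄z₈, b₂ = z₂z₄ + 2q z₁z₇, b₃ = z₂z₃ - 4q z₁z₈, b₄ = z₂³ + 12q z₇², b₅ = z₁z₂² - 6z₄z₇, b₆ = z₁²z₂ - q z₄², equals the vanishing locus of the single quartic x₃⁴ + 2q x₃²x₄² + x₄⁴ (i.e. the preimage S₁ × C₂ of the Weil divisor W₂). -/

import Mathlib

noncomputable section

open MvPolynomial

/-- ω = e^{2πi/3} -/
noncomputable def ω : ℂ := Complex.exp (2 * Real.pi * Complex.I / 3)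

/-- q = 2ω+1, a square root of -3 -/
noncomputable def q : ℂ := 2 * ω + 1

/-- the eight basic invariants of Table 1 (variables x₁,x₂,x₃,x₄ = X 0, X 1, X 2, X 3) -/
noncomputable def z : Fin 8 → MvPolynomial (Fin 4) ℂ :=
  ![X 0 * X 2 + X 1 * X 3,
    X 2 ^ 4 - C (2 * q) * X 2 ^ 2 * X 3 ^ 2 + X 3 ^ 4,
    X 0 ^ 4 + C (2 * q) * X 0 ^ 2 * X 1 ^ 2 + X 1 ^ 4,
    X 1 * X 2 ^ 3 - C q * X 0 * X 2 ^ 2 * X 3 + C q * X 1 * X 2 * X 3 ^ 2 - X 0 * X 3 ^ 3,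
    X 1 ^ 3 * X 2 - C q * X 0 ^ 2 * X 1 * X 2 + C q * X 0 * X 1 ^ 2 * X 3 - X 0 ^ 3 * X 3,
    X 0 ^ 5 * X 1 - X 0 * X 1 ^ 5,
    X 2 ^ 5 * X 3 - X 2 * X 3 ^ 5,
    X 0 * X 1 ^ 2 * X 2 ^ 3 - X 1 ^ 3 * X 2 ^ 2 * X 3 - X 0 ^ 3 * X 2 * X 3 ^ 2
      + X 0 ^ 2 * X 1 * X 3 ^ 3]

/-- φ : ℂ[z₁,…,z₈] → ℂ[x₁,x₂,x₃,x₄], the ℂ-algebra homomorphism substituting the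
eight basic invariants of Table 1 (zₖ = X (k-1)) -/
noncomputable def φ : MvPolynomial (Fin 8) ℂ →ₐ[ℂ] MvPolynomial (Fin 4) ℂ :=
  MvPolynomial.aeval z


/-- the six generators of Table 3 for the ideal of the Weil divisor W₂ ⊂ Z
(variables z₁,…,z₈ = X 0, …, X 7) -/
noncomputable def b : Fin 6 → MvPolynomial (Fin 8) ℂ :=
  ![X 2 * X 6 + 2 * X 3 * X 7,
    X 1 * X 3 + C (2 * q) * X 0 * X 6,
    X 1 * X 2 - C (4 * q) * X 0 * X 7,
    X 1 ^ 3 + C (12 * q) * X 6 ^ 2,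
    X 0 * X 1 ^ 2 - 6 * X 3 * X 6,
    X 0 ^ 2 * X 1 - C q * X 3 ^ 2]

/-!
STATEMENT 9: The common vanishing locus in ℂ⁴ of the six polynomials φ(b₁),…,φ(b₆)
of Table 3 equals the vanishing locus of the single quartic x₃⁴ + 2q x₃²x₄² + x₄⁴
(i.e. the preimage S₁ × C₂ of the Weil divisor W₂).
-/

theorem q_sq_eq : q ^ 2 = -3 := by
  have h3 : ω ^ 3 = 1 := by
    unfold ω
    rw [← Complex.exp_nat_mul, ← Complex.exp_two_pi_mul_I]
    congr 1
    push_cast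
    ring
  have h1 : ω ≠ 1 := by
    have := (Complex.isPrimitiveRoot_exp 3 (by norm_num)).ne_one (by norm_num)
    unfold ω
    simpa using this
  have h : (ω - 1) * (ω ^ 2 + ω + 1) = 0 := by linear_combination h3
  have h2 := (mul_eq_zero.mp h).resolve_left (sub_ne_zero.mpr h1)
  unfold q
  linear_combination 4 * h2

theorem vanishing_locus_of_W2_equations :
    {x : Fin 4 → ℂ | ∀ k : Fin 6, MvPolynomial.eval x (φ (b k)) = 0}
      = {x : Fin 4 → ℂ |
          x 2 ^ 4 + 2 * q * x 2 ^ 2 * x 3 ^ 2 + x 3 ^ 4 = 0} := by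
  have hq := q_sq_eq
  ext x
  simp only [Set.mem_ofPred_eq]
  constructor
  · intro h
    have h4 := h 3
    simp [φ, b, z] at h4
    generalize q = r at *
    generalize x 2 = s at *
    generalize x 3 = t at *
    have : (s ^ 4 + 2 * r * s ^ 2 * t ^ 2 + t ^ 4) ^ 3 = 0 := by
      linear_combination h4 + 16 * r * s ^ 6 * t ^ 6 * hq
    exact pow_eq_zero_iff (by norm_num) |>.mp this
  · intro h k
    fin_cases k <;> simp [φ, b, z, map_ofNat] <;> generalize q = r at * <;>
      generalize x 0 = u at * <;> generalize x 1 = v at * <;>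
      generalize x 2 = s at * <;> generalize x 3 = t at * <;> grind


end
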